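/- arXiv:2303.04282 — 3 statements merged into one kernel-verified Lean document; each statement's English description precedes it below -/
import Mathlib

section
/- Let D ⊆ ℝ^d and E ⊆ ℝ^p be compact sets, K a locally bounded cf-m kernel from D to finite signed Borel measures on E, and φ : E → ℝ a bounded Borel measurable function. Then the function x ↦ ∫_E φ(y) dK(x,·)(y) is continuous on D. -/
open MeasureTheory Filter Topology

/-- Integral of a real function against a finite signed measure, via Jordan decomposition. -/
noncomputable def signedIntegral {α : Type*} [MeasurableSpace α]
    (μ : SignedMeasure α) (f : α → ℝ) : ℝ :=
  ∫ x, f x ∂μ.toJordanDecomposition.posPart - ∫ x, f x ∂μ.toJordanDecomposition.negPart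

/-- A bounded measurable real function is a uniform limit of simple functions. -/
theorem exists_simpleFunc_abs_sub_le {α : Type*} [MeasurableSpace α] {f : α → ℝ}
    (hf : Measurable f) {c : ℝ} (hc : ∀ y, |f y| ≤ c) {ε : ℝ} (hε : 0 < ε) :
    ∃ g : SimpleFunc α ℝ, ∀ y, |f y - g y| ≤ ε := by
  have hm : Measurable fun y => (⌊f y / ε⌋ : ℤ) := (hf.div_const ε).floor
  have hfin : (Set.range fun y => (⌊f y / ε⌋ : ℤ)).Finite := by
    refine (Set.finite_Icc ⌊-c / ε⌋ ⌊c / ε⌋).subset ?_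
    rintro _ ⟨y, rfl⟩
    have h := abs_le.1 (hc y)
    exact ⟨Int.floor_le_floor (by gcongr; exact h.1), Int.floor_le_floor (by gcongr; exact h.2)⟩
  let n : SimpleFunc α ℤ := ⟨fun y => ⌊f y / ε⌋, fun k => hm (measurableSet_singleton k), hfin⟩
  refine ⟨n.map fun k : ℤ => ε * (k : ℝ), fun y => ?_⟩
  change |f y - ε * (⌊f y / ε⌋ : ℤ)| ≤ ε
  have h : f y - ε * (⌊f y / ε⌋ : ℤ) = ε * Int.fract (f y / ε) := by
    rw [Int.fract, mul_sub, mul_div_cancel₀ _ hε.ne']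
  rw [h, abs_of_nonneg (mul_nonneg hε.le (Int.fract_nonneg _))]
  exact mul_le_of_le_one_right hε.le (Int.fract_lt_one _).le

theorem signedIntegral_simpleFunc {α : Type*} [MeasurableSpace α] (μ : SignedMeasure α)
    (g : SimpleFunc α ℝ) : signedIntegral μ g = ∑ r ∈ g.range, μ (g ⁻¹' {r}) * r := by
  rw [signedIntegral, SimpleFunc.integral_eq_sum _ (SimpleFunc.integrable_of_isFiniteMeasure g),
    SimpleFunc.integral_eq_sum _ (SimpleFunc.integrable_of_isFiniteMeasure g),
    ← Finset.sum_sub_distrib]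
  refine Finset.sum_congr rfl fun r _ => ?_
  rw [μ.apply_eq_posPart_real_sub_negPart_real (g.measurableSet_fiber r), smul_eq_mul,
    smul_eq_mul, sub_mul]

theorem abs_signedIntegral_sub_le {α : Type*} [MeasurableSpace α] (μ : SignedMeasure α)
    {f g : α → ℝ} (hf : ∀ ν : Measure α, IsFiniteMeasure ν → Integrable f ν)
    (hg : ∀ ν : Measure α, IsFiniteMeasure ν → Integrable g ν) {ε : ℝ}
    (h : ∀ y, |f y - g y| ≤ ε) :
    |signedIntegral μ f - signedIntegral μ g| ≤ ε * μ.totalVariation.real Set.univ := by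
  have key (ν : Measure α) [IsFiniteMeasure ν] :
      |∫ y, f y ∂ν - ∫ y, g y ∂ν| ≤ ε * ν.real Set.univ := by
    rw [← integral_sub (hf ν inferInstance) (hg ν inferInstance)]
    exact norm_integral_le_of_norm_le_const (f := fun y => f y - g y) (.of_forall h)
  have h₁ := abs_le.1 (key μ.toJordanDecomposition.posPart)
  have h₂ := abs_le.1 (key μ.toJordanDecomposition.negPart)
  rw [SignedMeasure.totalVariation, measureReal_add_apply, signedIntegral, signedIntegral, mul_add]
  exact abs_le.2 ⟨by linarith, by linarith⟩

/-- If `K` is a locally bounded cf-m kernel from the compact set `D` to finite signed Borel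
measures on the compact set `E`, and `φ : E → ℝ` is bounded Borel measurable, then
`x ↦ ∫_E φ(y) dK(x,·)(y)` is continuous on `D`. -/
theorem continuous_kernel_integral_of_boundedMeasurable
    {d p : ℕ} (D : Set (EuclideanSpace ℝ (Fin d))) (E : Set (EuclideanSpace ℝ (Fin p)))
    (hD : IsCompact D) (hE : IsCompact E)
    (K : D → SignedMeasure E)
    (hcfm : ∀ A : Set E, MeasurableSet A → Continuous fun x : D => K x A)
    (hbdd : (⨆ x : D, (K x).totalVariation Set.univ) < ⊤)
    (φ : E → ℝ) (hφmeas : Measurable φ) (hφbdd : ∃ c : ℝ, ∀ y : E, |φ y| ≤ c) :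
    Continuous fun x : D => signedIntegral (K x) φ := by
  obtain ⟨c, hc⟩ := hφbdd
  set M : ℝ := (⨆ x : D, (K x).totalVariation Set.univ).toReal
  have hM (x : D) : (K x).totalVariation.real Set.univ ≤ M :=
    ENNReal.toReal_mono hbdd.ne (le_iSup (fun x : D => (K x).totalVariation Set.univ) x)
  have hM₀ : 0 ≤ M := ENNReal.toReal_nonneg
  refine continuous_of_uniform_approx_of_continuous fun u hu => ?_
  obtain ⟨ε, hε, hεu⟩ := Metric.mem_uniformity_dist.1 hu
  have hδ : 0 < ε / (M + 1) := by positivity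
  obtain ⟨g, hg⟩ := exists_simpleFunc_abs_sub_le hφmeas hc hδ
  refine ⟨fun x => signedIntegral (K x) g, ?_, fun x => hεu ?_⟩
  · simp only [signedIntegral_simpleFunc]
    exact continuous_finsetSum _ fun r _ => (hcfm _ (g.measurableSet_fiber r)).mul_const r
  · rw [Real.dist_eq]
    refine (abs_signedIntegral_sub_le (K x)
      (fun ν _ => .of_bound hφmeas.aestronglyMeasurable c (.of_forall hc))
      (fun ν _ => SimpleFunc.integrable_of_isFiniteMeasure g) hg).trans_lt ?_
    calc ε / (M + 1) * (K x).totalVariation.real Set.univ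
        ≤ ε / (M + 1) * M := by gcongr; exact hM x
      _ < ε / (M + 1) * (M + 1) := by gcongr; linarith
      _ = ε := div_mul_cancel₀ _ (by positivity)
end

section
/- Let D ⊆ ℝ^d and E ⊆ ℝ^p be compact sets, K a locally bounded cf-m kernel from D to finite signed Borel measures on E, and μ a finite signed Borel measure on D. Let T be a finite signed Borel measure on D×E such that ∫_D ( ∫_E ψ(x,y) dK(x,·)(y) ) dμ(x) = ∫_{D×E} ψ dT for all continuous ψ : D×E → ℝ. Then: (1) the same identity ∫_D ( ∫_E ψ(x,y) dK(x,·)(y) ) dμ(x) = ∫_{D×E} ψ dT holds for every bounded Borel measurable ψ : D×E → ℝ; and (2) for all bounded Borel measurable φ : D → ℝ and ϕ : E → ℝ, ∫_{D×E} φ(x)ϕ(y) dT(x,y) = ∫_E ϕ dν_φ, where ν_φ is the finite signed Borel measure on E satisfying ν_φ(A) = ∫_D φ(x)·K(x,A) dμ(x) for all Borel A ⊆ E. -/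
open MeasureTheory Filter Topology

/-- Measurable real functions with a uniform bound. -/
structure BoundedMeasurable {α : Type*} [MeasurableSpace α] (f : α → ℝ) : Prop where
  measurable : Measurable f
  bounded : ∃ c : ℝ, ∀ x, |f x| ≤ c

namespace BoundedMeasurable

variable {α β : Type*} [MeasurableSpace α] [MeasurableSpace β] {f g : α → ℝ}

theorem add (hf : BoundedMeasurable f) (hg : BoundedMeasurable g) :
    BoundedMeasurable fun x => f x + g x := by
  obtain ⟨a, ha⟩ := hf.bounded
  obtain ⟨b, hb⟩ := hg.bounded
  exact ⟨hf.measurable.add hg.measurable, a + b, fun x =>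
    (abs_add_le _ _).trans (add_le_add (ha x) (hb x))⟩

theorem mul (hf : BoundedMeasurable f) (hg : BoundedMeasurable g) :
    BoundedMeasurable fun x => f x * g x := by
  obtain ⟨a, ha⟩ := hf.bounded
  obtain ⟨b, hb⟩ := hg.bounded
  refine ⟨hf.measurable.mul hg.measurable, a * b, fun x => ?_⟩
  rw [abs_mul]
  exact mul_le_mul (ha x) (hb x) (abs_nonneg _) ((abs_nonneg _).trans (ha x))

theorem const (c : ℝ) : BoundedMeasurable fun _ : α => c :=
  ⟨measurable_const, |c|, fun _ => le_rfl⟩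

theorem const_mul (c : ℝ) (hf : BoundedMeasurable f) : BoundedMeasurable fun x => c * f x :=
  (const c).mul hf

theorem indicator_one {s : Set α} (hs : MeasurableSet s) :
    BoundedMeasurable (s.indicator fun _ => (1 : ℝ)) :=
  ⟨measurable_const.indicator hs, 1, fun x => by by_cases h : x ∈ s <;> simp [h]⟩

theorem comp (hf : BoundedMeasurable f) {u : β → α} (hu : Measurable u) :
    BoundedMeasurable fun x => f (u x) := by
  obtain ⟨c, hc⟩ := hf.bounded
  exact ⟨hf.measurable.comp hu, c, fun x => hc _⟩

theorem simpleFunc (f : SimpleFunc α ℝ) : BoundedMeasurable f := by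
  obtain ⟨c, hc⟩ := f.exists_forall_norm_le
  exact ⟨f.measurable, c, hc⟩

theorem integrable (hf : BoundedMeasurable f) (μ : Measure α) [IsFiniteMeasure μ] :
    Integrable f μ := by
  obtain ⟨c, hc⟩ := hf.bounded
  exact .of_bound hf.measurable.aestronglyMeasurable c (ae_of_all _ hc)

/-- Functional monotone class theorem: a property of bounded measurable functions that is stable
under linear combinations and bounded pointwise limits holds for all of them as soon as it holds
for the constant `1` and for the indicators of a generating π-system. -/
theorem induction_on_piSystem {P : (α → ℝ) → Prop} {C : Set (Set α)}
    (h_gen : ‹MeasurableSpace α› = MeasurableSpace.generateFrom C) (h_pi : IsPiSystem C)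
    (one : P fun _ => 1) (basic : ∀ s ∈ C, P (s.indicator fun _ => 1))
    (const_mul : ∀ (c : ℝ) f, BoundedMeasurable f → P f → P fun x => c * f x)
    (add : ∀ f g, BoundedMeasurable f → BoundedMeasurable g → P f → P g → P fun x => f x + g x)
    (lim : ∀ (F : ℕ → α → ℝ) f (c : ℝ), (∀ n, Measurable (F n)) → (∀ n x, |F n x| ≤ c) →
      (∀ x, Tendsto (fun n => F n x) atTop (𝓝 (f x))) → (∀ n, P (F n)) → P f)
    (hf : BoundedMeasurable f) : P f := by
  have zero : P fun _ => 0 := by simpa using const_mul 0 _ (.const 1) one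
  have ind : ∀ s, MeasurableSet s → P (s.indicator fun _ => 1) := by
    intro s hs
    induction s, hs using MeasurableSpace.induction_on_inter h_gen h_pi with
    | empty => simpa using zero
    | basic t ht => exact basic t ht
    | compl t ht ih =>
      convert add _ _ (.const 1) ((indicator_one ht).const_mul (-1)) one
        (const_mul (-1) _ (indicator_one ht) ih) using 1
      ext x
      by_cases h : x ∈ t <;> simp [h]
    | iUnion u hd hu ih =>
      have partial_union : ∀ n : ℕ, P ((⋃ i < n, u i).indicator fun _ => 1) := by
        intro n
        induction n with
        | zero => simpa using zero
        | succ n hn =>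
          have hm : MeasurableSet (⋃ i < n, u i) :=
            MeasurableSet.iUnion fun i => MeasurableSet.iUnion fun _ => hu i
          convert add _ _ (indicator_one hm) (indicator_one (hu n)) hn (ih n) using 1
          have hdis : Disjoint (⋃ i < n, u i) (u n) := by
            simp only [Set.disjoint_iUnion_left]
            exact fun i hi => hd hi.ne
          rw [Set.biUnion_lt_succ, Set.indicator_union_of_disjoint hdis]
      refine lim (fun n => (⋃ i < n, u i).indicator fun _ => 1) _ 1
        (fun n => (indicator_one (MeasurableSet.iUnion fun i =>
          MeasurableSet.iUnion fun _ => hu i)).measurable) (fun n x => ?_) (fun x => ?_)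
        partial_union
      · by_cases h : x ∈ ⋃ i < n, u i <;> simp only [h, Set.indicator_of_mem,
          Set.indicator_of_notMem, not_false_eq_true, abs_one, abs_zero, le_refl, zero_le_one]
      · by_cases h : x ∈ ⋃ i, u i
        · obtain ⟨i, hi⟩ := Set.mem_iUnion.1 h
          rw [Set.indicator_of_mem h]
          refine tendsto_const_nhds.congr' ?_
          filter_upwards [eventually_gt_atTop i] with n hn
          rw [Set.indicator_of_mem (Set.mem_iUnion₂.2 ⟨i, hn, hi⟩)]
        · rw [Set.indicator_of_notMem h]
          refine tendsto_const_nhds.congr fun n => ?_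
          rw [Set.indicator_of_notMem]
          exact fun h' => h (Set.iUnion₂_subset_iUnion _ _ h')
  have simple : ∀ g : SimpleFunc α ℝ, P g := by
    intro g
    induction g using SimpleFunc.induction with
    | @const c s hs =>
      convert const_mul c _ (indicator_one hs) (ind _ hs) using 1
      ext x
      by_cases h : x ∈ s <;> simp [h]
    | add _ hf hg => exact add _ _ (.simpleFunc _) (.simpleFunc _) hf hg
  obtain ⟨c, hc⟩ := hf.bounded
  have hc' : ∀ x, ‖f x‖ ≤ max c 0 := fun x => (hc x).trans (le_max_left _ _)
  exact lim (fun n => hf.measurable.stronglyMeasurable.approxBounded (max c 0) n) f (max c 0)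
    (fun n => SimpleFunc.measurable _)
    (fun n x => hf.measurable.stronglyMeasurable.norm_approxBounded_le (le_max_right _ _) n x)
    (fun x => hf.measurable.stronglyMeasurable.tendsto_approxBounded_of_norm_le (hc' x))
    (fun n => simple _)

end BoundedMeasurable

section signedIntegral

variable {α : Type*} [MeasurableSpace α] (μ : SignedMeasure α) {f g : α → ℝ}

theorem signedIntegral_add (hf : BoundedMeasurable f) (hg : BoundedMeasurable g) :
    signedIntegral μ (fun x => f x + g x) = signedIntegral μ f + signedIntegral μ g := by
  simp only [signedIntegral]
  rw [integral_add (hf.integrable _) (hg.integrable _),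
    integral_add (hf.integrable _) (hg.integrable _)]
  ring

theorem signedIntegral_const_mul (c : ℝ) (f : α → ℝ) :
    signedIntegral μ (fun x => c * f x) = c * signedIntegral μ f := by
  simp only [signedIntegral, integral_const_mul]
  ring

theorem signedIntegral_indicator_one {s : Set α} (hs : MeasurableSet s) :
    signedIntegral μ (s.indicator fun _ => 1) = μ s := by
  simp [signedIntegral, integral_indicator_const _ hs,
    μ.apply_eq_posPart_real_sub_negPart_real hs]

theorem signedIntegral_one : signedIntegral μ (fun _ => 1) = μ Set.univ := by
  simpa using signedIntegral_indicator_one μ MeasurableSet.univ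

theorem tendsto_signedIntegral {F : ℕ → α → ℝ} {c : ℝ} (hF : ∀ n, Measurable (F n))
    (hc : ∀ n x, |F n x| ≤ c) (hlim : ∀ x, Tendsto (fun n => F n x) atTop (𝓝 (f x))) :
    Tendsto (fun n => signedIntegral μ (F n)) atTop (𝓝 (signedIntegral μ f)) := by
  have key (ν : Measure α) [IsFiniteMeasure ν] :
      Tendsto (fun n => ∫ x, F n x ∂ν) atTop (𝓝 (∫ x, f x ∂ν)) :=
    tendsto_integral_of_dominated_convergence (fun _ => c)
      (fun n => (hF n).aestronglyMeasurable) (integrable_const c)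
      (fun n => ae_of_all _ (hc n)) (ae_of_all _ hlim)
  exact (key _).sub (key _)

theorem abs_signedIntegral_le {c : ℝ} (hc : ∀ x, |f x| ≤ c) :
    |signedIntegral μ f| ≤ c * (μ.totalVariation Set.univ).toReal := by
  have key (ν : Measure α) [IsFiniteMeasure ν] : |∫ x, f x ∂ν| ≤ c * (ν Set.univ).toReal := by
    exact norm_integral_le_of_norm_le_const (μ := ν) (f := f) (C := c) (ae_of_all _ hc)
  rw [SignedMeasure.totalVariation, Measure.add_apply,
    ENNReal.toReal_add (measure_ne_top _ _) (measure_ne_top _ _), mul_add]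
  exact (abs_sub _ _).trans (add_le_add (key _) (key _))

end signedIntegral

section kernel

variable {α β : Type*} [MeasurableSpace α] [MeasurableSpace β] {K : α → SignedMeasure β}
  {ψ : α × β → ℝ}

theorem measurable_signedIntegral_kernel
    (hK : ∀ A : Set β, MeasurableSet A → Measurable fun x => K x A)
    (hψ : BoundedMeasurable ψ) : Measurable fun x => signedIntegral (K x) fun y => ψ (x, y) := by
  refine hψ.induction_on_piSystem
    (P := fun ψ => Measurable fun x => signedIntegral (K x) fun y => ψ (x, y))
    generateFrom_prod.symm isPiSystem_prod ?_ ?_ ?_ ?_ ?_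
  · simpa only [signedIntegral_one] using hK _ .univ
  · rintro _ ⟨A, hA, B, hB, rfl⟩
    have : (fun x => signedIntegral (K x) fun y => (A ×ˢ B).indicator (fun _ => 1) (x, y)) =
        A.indicator fun x => K x B := by
      ext x
      by_cases h : x ∈ A
      · rw [Set.indicator_of_mem h, ← signedIntegral_indicator_one _ hB]
        refine congrArg _ (funext fun y => ?_)
        by_cases hy : y ∈ B <;> simp [h, hy]
      · simp [h, signedIntegral]
    rw [this]
    exact (hK B hB).indicator hA
  · intro c f _ ih
    simpa only [signedIntegral_const_mul] using ih.const_mul c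
  · intro f g hf hg ihf ihg
    convert ihf.add ihg using 1
    exact funext fun x => signedIntegral_add (K x) (hf.comp measurable_prodMk_left)
      (hg.comp measurable_prodMk_left)
  · intro F f c hF hc hlim ih
    exact measurable_of_tendsto_metrizable ih (tendsto_pi_nhds.2 fun x =>
      tendsto_signedIntegral (K x) (fun n => (hF n).comp measurable_prodMk_left)
        (fun n y => hc n (x, y)) fun y => hlim (x, y))

theorem abs_signedIntegral_kernel_le {α : Type*} {K : α → SignedMeasure β} {ψ : α × β → ℝ}
    (hbdd : (⨆ x, (K x).totalVariation Set.univ) < ⊤) {c : ℝ} (hc : ∀ q, |ψ q| ≤ c) (x : α) :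
    |signedIntegral (K x) fun y => ψ (x, y)| ≤
      max c 0 * (⨆ x, (K x).totalVariation Set.univ).toReal :=
  (abs_signedIntegral_le (K x) fun y => (hc (x, y)).trans (le_max_left c 0)).trans
    (mul_le_mul_of_nonneg_left (ENNReal.toReal_mono hbdd.ne
      (le_iSup (fun x => (K x).totalVariation Set.univ) x)) (le_max_right _ _))

theorem BoundedMeasurable.signedIntegral_kernel
    (hK : ∀ A : Set β, MeasurableSet A → Measurable fun x => K x A)
    (hbdd : (⨆ x, (K x).totalVariation Set.univ) < ⊤) (hψ : BoundedMeasurable ψ) :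
    BoundedMeasurable fun x => signedIntegral (K x) fun y => ψ (x, y) :=
  ⟨measurable_signedIntegral_kernel hK hψ,
    hψ.bounded.elim fun _ hc => ⟨_, abs_signedIntegral_kernel_le hbdd hc⟩⟩

end kernel

/-- Iterated integral identities for continuous functions extend to bounded Borel functions. -/
theorem signedIntegral_kernel_eq_of_continuous {α β : Type*} [TopologicalSpace α]
    [TopologicalSpace β] [MeasurableSpace α] [MeasurableSpace β] [BorelSpace (α × β)]
    [HasOuterApproxClosed (α × β)] {K : α → SignedMeasure β}
    (hK : ∀ A : Set β, MeasurableSet A → Measurable fun x => K x A)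
    (hbdd : (⨆ x, (K x).totalVariation Set.univ) < ⊤)
    (μ : SignedMeasure α) (T : SignedMeasure (α × β))
    (hT : ∀ ψ : α × β → ℝ, Continuous ψ →
      signedIntegral μ (fun x => signedIntegral (K x) fun y => ψ (x, y)) = signedIntegral T ψ)
    {ψ : α × β → ℝ} (hψ : BoundedMeasurable ψ) :
    signedIntegral μ (fun x => signedIntegral (K x) fun y => ψ (x, y)) = signedIntegral T ψ := by
  have lim (F : ℕ → α × β → ℝ) (f : α × β → ℝ) (c : ℝ) (hF : ∀ n, Measurable (F n))
      (hc : ∀ n q, |F n q| ≤ c) (hlim : ∀ q, Tendsto (fun n => F n q) atTop (𝓝 (f q)))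
      (h : ∀ n, signedIntegral μ (fun x => signedIntegral (K x) fun y => F n (x, y)) =
        signedIntegral T (F n)) :
      signedIntegral μ (fun x => signedIntegral (K x) fun y => f (x, y)) =
        signedIntegral T f := by
    refine tendsto_nhds_unique ?_ (tendsto_signedIntegral T hF hc hlim)
    simp only [← h]
    exact tendsto_signedIntegral μ
      (fun n => measurable_signedIntegral_kernel hK ⟨hF n, c, hc n⟩)
      (fun n => abs_signedIntegral_kernel_le hbdd (hc n)) fun x =>
        tendsto_signedIntegral (K x) (fun n => (hF n).comp measurable_prodMk_left)
          (fun n y => hc n (x, y)) fun y => hlim (x, y)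
  refine hψ.induction_on_piSystem
    (P := fun ψ => signedIntegral μ (fun x => signedIntegral (K x) fun y => ψ (x, y)) =
      signedIntegral T ψ)
    ((BorelSpace.measurable_eq (α := α × β)).trans borel_eq_generateFrom_isClosed)
    isPiSystem_isClosed (hT _ continuous_const) ?_ ?_ ?_ lim
  · intro s hs
    have happr (n : ℕ) : Continuous fun q => (hs.apprSeq n q : ℝ) :=
      NNReal.continuous_coe.comp (hs.apprSeq n).continuous
    refine lim (fun n q => hs.apprSeq n q) _ 1 (fun n => (happr n).measurable) (fun n q => ?_)
      (fun q => ?_) fun n => hT _ (happr n)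
    · rw [NNReal.abs_eq]
      exact_mod_cast HasOuterApproxClosed.apprSeq_apply_le_one hs n q
    · have h := NNReal.tendsto_coe.2
        (tendsto_pi_nhds.1 (HasOuterApproxClosed.tendsto_apprSeq hs) q)
      by_cases hq : q ∈ s <;> simpa [hq] using h
  · intro c f hf ih
    simp only [signedIntegral_const_mul, ih]
  · intro f g hf hg ihf ihg
    rw [signedIntegral_add T hf hg, ← ihf, ← ihg,
      ← signedIntegral_add μ (hf.signedIntegral_kernel hK hbdd) (hg.signedIntegral_kernel hK hbdd)]
    congr 1
    ext x
    exact signedIntegral_add (K x) (hf.comp measurable_prodMk_left)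
      (hg.comp measurable_prodMk_left)

/-- If `T` represents the iterated kernel integrals of continuous functions, then (1) it
represents them for every bounded Borel measurable `ψ : D × E → ℝ`, and (2) for bounded Borel
measurable `φ : D → ℝ`, `ϕ : E → ℝ`, `∫_{D×E} φ(x)ϕ(y) dT(x,y) = ∫_E ϕ dν_φ`, where
`ν_φ(A) = ∫_D φ(x)·K(x,A) dμ(x)`. -/
theorem kernel_measure_extension_and_fubini
    {d p : ℕ} (D : Set (EuclideanSpace ℝ (Fin d))) (E : Set (EuclideanSpace ℝ (Fin p)))
    (hD : IsCompact D) (hE : IsCompact E)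
    (K : D → SignedMeasure E)
    (hcfm : ∀ A : Set E, MeasurableSet A → Continuous fun x : D => K x A)
    (hbdd : (⨆ x : D, (K x).totalVariation Set.univ) < ⊤)
    (μ : SignedMeasure D)
    (T : SignedMeasure (D × E))
    (hT : ∀ ψ : D × E → ℝ, Continuous ψ →
      signedIntegral μ (fun x => signedIntegral (K x) (fun y => ψ (x, y))) =
        signedIntegral T ψ) :
    (∀ ψ : D × E → ℝ, Measurable ψ → (∃ c : ℝ, ∀ q : D × E, |ψ q| ≤ c) →
      signedIntegral μ (fun x => signedIntegral (K x) (fun y => ψ (x, y))) =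
        signedIntegral T ψ) ∧
    (∀ (φ : D → ℝ), Measurable φ → (∃ c : ℝ, ∀ x : D, |φ x| ≤ c) →
      ∀ (ϕ : E → ℝ), Measurable ϕ → (∃ c : ℝ, ∀ y : E, |ϕ y| ≤ c) →
      ∀ ν : SignedMeasure E,
        (∀ A : Set E, MeasurableSet A → ν A = signedIntegral μ (fun x => φ x * K x A)) →
        signedIntegral T (fun q => φ q.1 * ϕ q.2) = signedIntegral ν ϕ) := by
  have := isCompact_iff_compactSpace.1 hD
  have hK : ∀ A : Set E, MeasurableSet A → Measurable fun x : D => K x A :=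
    fun A hA => (hcfm A hA).measurable
  have part_one {ψ : D × E → ℝ} (hψ : BoundedMeasurable ψ) :=
    signedIntegral_kernel_eq_of_continuous hK hbdd μ T hT hψ
  refine ⟨fun ψ hψ hb => part_one ⟨hψ, hb⟩, fun φ hφ hφb ϕ hϕ hϕb ν hν => ?_⟩
  have hφ' : BoundedMeasurable fun q : D × E => φ q.1 :=
    BoundedMeasurable.comp ⟨hφ, hφb⟩ measurable_fst
  have indicator_case (A : Set E) (hA : MeasurableSet A) :
      signedIntegral T (fun q => φ q.1 * A.indicator (fun _ => 1) q.2) =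
        signedIntegral ν (A.indicator fun _ => 1) := by
    rw [signedIntegral_indicator_one ν hA, hν A hA,
      ← part_one (hφ'.mul ((BoundedMeasurable.indicator_one hA).comp measurable_snd))]
    simp only [signedIntegral_const_mul]
    exact congrArg _ (funext fun x => by rw [← signedIntegral_indicator_one (K x) hA])
  refine BoundedMeasurable.induction_on_piSystem (f := ϕ)
    (P := fun ϕ => signedIntegral T (fun q => φ q.1 * ϕ q.2) = signedIntegral ν ϕ)
    MeasurableSpace.generateFrom_measurableSet.symm MeasurableSpace.isPiSystem_measurableSet
    ?_ indicator_case ?_ ?_ ?_ ⟨hϕ, hϕb⟩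
  · simpa using indicator_case Set.univ .univ
  · intro c f _ ih
    rw [signedIntegral_const_mul, ← ih, ← signedIntegral_const_mul]
    simp only [mul_left_comm]
  · intro f g hf hg ihf ihg
    rw [signedIntegral_add ν hf hg, ← ihf, ← ihg,
      ← signedIntegral_add T (hφ'.mul (hf.comp measurable_snd)) (hφ'.mul (hg.comp measurable_snd))]
    simp only [mul_add]
  · intro F f c hF hc hlim ih
    refine tendsto_nhds_unique ?_ (tendsto_signedIntegral ν hF hc hlim)
    simp only [← ih]
    obtain ⟨a, ha⟩ := hφb
    refine tendsto_signedIntegral (c := a * c) T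
      (fun n => hφ'.measurable.mul ((hF n).comp measurable_snd)) (fun n q => ?_)
      fun q => (hlim q.2).const_mul _
    rw [abs_mul]
    exact mul_le_mul (ha _) (hc _ _) (abs_nonneg _) ((abs_nonneg _).trans (ha q.1))
end

section
/- Let K be a cf-m kernel over ℝ^d (K(x,·) a finite signed Borel measure on ℝ^d for each x ∈ ℝ^d, and x ↦ K(x,A) continuous for every Borel A), and let D ⊆ ℝ^d be a bounded Borel set. If K is self-integrable over D, then K is self-integrable over every Borel subset A ⊆ D, and the additivity property ∫_A K(x,dx) + ∫_{D∖A} K(x,dx) = ∫_D K(x,dx) holds. -/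
open MeasureTheory Filter Topology

/-- A Riemann system of a bounded Borel set `D`: a sequence of finite partitions of `D` into
nonempty Borel pieces with tag points, whose maximal diameter tends to `0`. -/
structure RiemannSystem {α : Type*} [MeasurableSpace α] [PseudoMetricSpace α] (D : Set α) where
  J : ℕ → Finset ℕ
  piece : ℕ → ℕ → Set α
  tag : ℕ → ℕ → α
  measurable : ∀ n, ∀ j ∈ J n, MeasurableSet (piece n j)
  nonempty : ∀ n, ∀ j ∈ J n, (piece n j).Nonempty
  disj : ∀ n, ∀ j ∈ J n, ∀ k ∈ J n, j ≠ k → Disjoint (piece n j) (piece n k)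
  cover : ∀ n, (⋃ j ∈ J n, piece n j) = D
  tag_mem : ∀ n, ∀ j ∈ J n, tag n j ∈ piece n j
  diam_small : ∀ ε : ℝ, 0 < ε → ∃ N : ℕ, ∀ n ≥ N, ∀ j ∈ J n, Metric.diam (piece n j) ≤ ε

namespace RiemannSystem

variable {α : Type*} [MeasurableSpace α] [PseudoMetricSpace α] {A B : Set α}

/-- The Riemann sums of a function of a tag point and a set along a Riemann system. -/
def riemannSum (R : RiemannSystem A) (F : α → Set α → ℝ) (n : ℕ) : ℝ :=
  ∑ j ∈ R.J n, F (R.tag n j) (R.piece n j)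

/-- The Riemann system obtained by passing to a sequence of indices tending to infinity. -/
def reindex (R : RiemannSystem A) (φ : ℕ → ℕ) (hφ : Tendsto φ atTop atTop) :
    RiemannSystem A where
  J n := R.J (φ n)
  piece n := R.piece (φ n)
  tag n := R.tag (φ n)
  measurable n := R.measurable (φ n)
  nonempty n := R.nonempty (φ n)
  disj n := R.disj (φ n)
  cover n := R.cover (φ n)
  tag_mem n := R.tag_mem (φ n)
  diam_small ε hε := by
    obtain ⟨N, hN⟩ := R.diam_small ε hε
    obtain ⟨M, hM⟩ := eventually_atTop.1 (hφ.eventually_ge_atTop N)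
    exact ⟨M, fun n hn => hN _ (hM n hn)⟩

theorem piece_subset (R : RiemannSystem A) {n j : ℕ} (hj : j ∈ R.J n) : R.piece n j ⊆ A :=
  (Set.subset_biUnion_of_mem (u := R.piece n) hj).trans (R.cover n).subset

/-- The Riemann system of a disjoint union made of the pieces of two Riemann systems. -/
def union (R : RiemannSystem A) (Q : RiemannSystem B) (h : Disjoint A B) :
    RiemannSystem (A ∪ B) where
  J n := ((R.J n).disjSum (Q.J n)).map Equiv.natSumNatEquivNat.toEmbedding
  piece n j := Sum.elim (R.piece n) (Q.piece n) (Equiv.natSumNatEquivNat.symm j)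
  tag n j := Sum.elim (R.tag n) (Q.tag n) (Equiv.natSumNatEquivNat.symm j)
  measurable n := by
    rw [Finset.forall_mem_map]
    rintro (i | i) hi
    · simpa using R.measurable n i (by simpa using hi)
    · simpa using Q.measurable n i (by simpa using hi)
  nonempty n := by
    rw [Finset.forall_mem_map]
    rintro (i | i) hi
    · simpa using R.nonempty n i (by simpa using hi)
    · simpa using Q.nonempty n i (by simpa using hi)
  disj n := by
    simp only [Finset.forall_mem_map, Equiv.coe_toEmbedding, Equiv.symm_apply_apply, ne_eq,
      Equiv.apply_eq_iff_eq]
    rintro (i | i) hi (k | k) hk hne <;>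
      simp only [Finset.inl_mem_disjSum, Finset.inr_mem_disjSum] at hi hk
    · exact R.disj n i hi k hk (by simpa using hne)
    · exact h.mono (R.piece_subset hi) (Q.piece_subset hk)
    · exact h.symm.mono (Q.piece_subset hi) (R.piece_subset hk)
    · exact Q.disj n i hi k hk (by simpa using hne)
  cover n := by
    refine Eq.trans ?_ (congrArg₂ (· ∪ ·) (R.cover n) (Q.cover n))
    ext x
    simp only [Set.mem_iUnion, Set.mem_union, exists_prop, Finset.mem_map_equiv]
    rw [Equiv.natSumNatEquivNat.symm.exists_congr_left, Sum.exists]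
    simp
  tag_mem n := by
    rw [Finset.forall_mem_map]
    rintro (i | i) hi
    · simpa using R.tag_mem n i (by simpa using hi)
    · simpa using Q.tag_mem n i (by simpa using hi)
  diam_small ε hε := by
    obtain ⟨N, hN⟩ := R.diam_small ε hε
    obtain ⟨M, hM⟩ := Q.diam_small ε hε
    refine ⟨max N M, fun n hn => ?_⟩
    rw [Finset.forall_mem_map]
    rintro (i | i) hi
    · simpa using hN n (le_of_max_le_left hn) i (by simpa using hi)
    · simpa using hM n (le_of_max_le_right hn) i (by simpa using hi)

theorem riemannSum_union (R : RiemannSystem A) (Q : RiemannSystem B) (h : Disjoint A B)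
    (F : α → Set α → ℝ) (n : ℕ) :
    (R.union Q h).riemannSum F n = R.riemannSum F n + Q.riemannSum F n := by
  simp [riemannSum, union, Finset.sum_map, Finset.sum_disjSum]

end RiemannSystem

open Classical in
theorem TotallyBounded.exists_measurable_partition {α : Type*} [MeasurableSpace α]
    [PseudoMetricSpace α] [OpensMeasurableSpace α] [Nonempty α] {A : Set α}
    (hA : TotallyBounded A) (hAm : MeasurableSet A) {ε : ℝ} (hε : 0 < ε) :
    ∃ (m : ℕ) (P : ℕ → Set α), (∀ j, MeasurableSet (P j)) ∧ Pairwise (Function.onFun Disjoint P) ∧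
      (⋃ j ∈ Finset.range m, P j) = A ∧ ∀ j, Metric.diam (P j) ≤ ε := by
  obtain ⟨t, ht, hAt⟩ := Metric.totallyBounded_iff.1 hA (ε / 2) (half_pos hε)
  obtain ⟨m, f, rfl⟩ := ht.fin_embedding
  let c : ℕ → α := fun i => if h : i < m then f ⟨i, h⟩ else Classical.arbitrary α
  let U : ℕ → Set α := fun i => Metric.ball (c i) (ε / 2)
  refine ⟨m, fun j => A ∩ disjointed U j, fun j => hAm.inter (.disjointed
    (fun i => Metric.isOpen_ball.measurableSet) j), fun i j hij =>
    (disjoint_disjointed U hij).mono Set.inter_subset_right Set.inter_subset_right, ?_, fun j => ?_⟩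
  · refine (Set.iUnion₂_subset fun _ _ => Set.inter_subset_left).antisymm fun x hx => ?_
    obtain ⟨i, hi⟩ : ∃ i : Fin m, x ∈ Metric.ball (f i) (ε / 2) := by simpa using hAt hx
    have hU : ∃ i, x ∈ U i := ⟨i, by simpa [U, c] using hi⟩
    have hle : Nat.find hU < m :=
      (Nat.find_min' hU (m := i) (by simpa [U, c] using hi)).trans_lt i.2
    refine Set.mem_biUnion (x := Nat.find hU) (by simpa using hle) ⟨hx, ?_⟩
    rw [disjointed_eq_inter_compl]
    refine ⟨Nat.find_spec hU, ?_⟩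
    simp only [Set.mem_iInter]
    exact fun k hk => Nat.find_min hU hk
  · refine (Metric.diam_mono (Set.inter_subset_right.trans (disjointed_subset U j))
      Metric.isBounded_ball).trans ?_
    exact (Metric.diam_ball (half_pos hε).le).trans_eq (by ring)

open Classical in
theorem TotallyBounded.nonempty_riemannSystem {α : Type*} [MeasurableSpace α]
    [PseudoMetricSpace α] [OpensMeasurableSpace α] [Nonempty α] {A : Set α}
    (hA : TotallyBounded A) (hAm : MeasurableSet A) : Nonempty (RiemannSystem A) := by
  choose m P hPm hPd hPc hPe using fun n : ℕ =>
    hA.exists_measurable_partition hAm (Nat.one_div_pos_of_nat (α := ℝ) (n := n))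
  exact ⟨{
    J := fun n => (Finset.range (m n)).filter fun j => (P n j).Nonempty
    piece := P
    tag := fun n j => if h : (P n j).Nonempty then h.some else Classical.arbitrary α
    measurable := fun n j _ => hPm n j
    nonempty := fun n j hj => (Finset.mem_filter.1 hj).2
    disj := fun n j _ k _ hjk => hPd n hjk
    cover := fun n => by
      rw [← hPc n]
      ext x
      simp only [Set.mem_iUnion, Finset.mem_filter, exists_prop]
      exact ⟨fun ⟨j, hj, hx⟩ => ⟨j, hj.1, hx⟩, fun ⟨j, hj, hx⟩ => ⟨j, ⟨hj, x, hx⟩, hx⟩⟩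
    tag_mem := fun n j hj => by
      rw [dif_pos (Finset.mem_filter.1 hj).2]
      exact Set.Nonempty.some_mem _
    diam_small := fun ε hε => by
      obtain ⟨N, hN⟩ := exists_nat_one_div_lt hε
      exact ⟨N, fun n hn j _ => (hPe n j).trans
        ((Nat.one_div_le_one_div hn).trans hN.le)⟩ }⟩

/-- If the Riemann sums over a disjoint union converge along every Riemann system, then so do the
Riemann sums over the first set, provided the second one has a Riemann system. -/
theorem RiemannSystem.exists_tendsto_riemannSum_of_union {α : Type*} [MeasurableSpace α]
    [PseudoMetricSpace α] {A B : Set α} (h : Disjoint A B) (F : α → Set α → ℝ) {ℓ : ℝ}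
    (hF : ∀ R : RiemannSystem (A ∪ B), Tendsto (R.riemannSum F) atTop (𝓝 ℓ))
    (R₀ : RiemannSystem A) (Q : RiemannSystem B) :
    ∃ ℓA : ℝ, ∀ R : RiemannSystem A, Tendsto (R.riemannSum F) atTop (𝓝 ℓA) := by
  have hsub (R R' : RiemannSystem A) :
      Tendsto (fun n => R.riemannSum F n - R'.riemannSum F n) atTop (𝓝 0) := by
    simpa [RiemannSystem.riemannSum_union] using (hF (R.union Q h)).sub (hF (R'.union Q h))
  have hcauchy : CauchySeq (R₀.riemannSum F) := by
    rw [Metric.cauchySeq_iff]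
    by_contra! hcon
    obtain ⟨ε, hε, hcon⟩ := hcon
    choose m hm n hn hmn using hcon
    obtain ⟨k, hk⟩ := ((hsub (R₀.reindex m (tendsto_atTop_mono hm tendsto_id))
      (R₀.reindex n (tendsto_atTop_mono hn tendsto_id))).eventually
        (Metric.ball_mem_nhds 0 hε)).exists
    rw [dist_zero_right, ← dist_eq_norm] at hk
    exact (hmn k).not_gt hk
  obtain ⟨ℓA, hℓA⟩ := cauchySeq_tendsto_of_complete hcauchy
  exact ⟨ℓA, fun R => by simpa using (hsub R R₀).add hℓA⟩

/-- A self-integrable cf-m kernel over a bounded Borel set `D` is self-integrable over every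
Borel subset `A ⊆ D`, and the self-integrals are additive:
`∫_A K(x,dx) + ∫_{D∖A} K(x,dx) = ∫_D K(x,dx)`. -/
theorem selfIntegrable_subset_and_additive
    {d : ℕ} (K : EuclideanSpace ℝ (Fin d) → SignedMeasure (EuclideanSpace ℝ (Fin d)))
    (hK : ∀ A : Set (EuclideanSpace ℝ (Fin d)), MeasurableSet A →
      Continuous fun x => K x A)
    (D : Set (EuclideanSpace ℝ (Fin d))) (hDb : Bornology.IsBounded D) (hDm : MeasurableSet D)
    (ℓ : ℝ)
    (hself : ∀ R : RiemannSystem D,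
      Tendsto (fun n => ∑ j ∈ R.J n, K (R.tag n j) (R.piece n j)) atTop (𝓝 ℓ)) :
    ∀ A : Set (EuclideanSpace ℝ (Fin d)), MeasurableSet A → A ⊆ D →
      ∃ ℓA ℓB : ℝ,
        (∀ R : RiemannSystem A,
          Tendsto (fun n => ∑ j ∈ R.J n, K (R.tag n j) (R.piece n j)) atTop (𝓝 ℓA)) ∧
        (∀ R : RiemannSystem (D \ A),
          Tendsto (fun n => ∑ j ∈ R.J n, K (R.tag n j) (R.piece n j)) atTop (𝓝 ℓB)) ∧
        ℓA + ℓB = ℓ := by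
  intro A hA hAD
  have hrs {S : Set (EuclideanSpace ℝ (Fin d))} (hS : MeasurableSet S) (hSD : S ⊆ D) :
      Nonempty (RiemannSystem S) :=
    (hDb.subset hSD).isCompact_closure.totallyBounded.subset subset_closure
      |>.nonempty_riemannSystem hS
  obtain ⟨R₀⟩ := hrs hA hAD
  obtain ⟨Q₀⟩ := hrs (hDm.diff hA) Set.sdiff_subset
  let F : EuclideanSpace ℝ (Fin d) → Set (EuclideanSpace ℝ (Fin d)) → ℝ := fun x S => K x S
  have hdisj : Disjoint A (D \ A) := Set.disjoint_sdiff_right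
  have hAB : ∀ R : RiemannSystem (A ∪ D \ A), Tendsto (R.riemannSum F) atTop (𝓝 ℓ) := by
    rw [Set.union_sdiff_cancel hAD]
    exact hself
  have hBA : ∀ R : RiemannSystem (D \ A ∪ A), Tendsto (R.riemannSum F) atTop (𝓝 ℓ) := by
    rw [Set.sdiff_union_of_subset hAD]
    exact hself
  obtain ⟨ℓA, hℓA⟩ :=
    RiemannSystem.exists_tendsto_riemannSum_of_union hdisj F hAB R₀ Q₀
  obtain ⟨ℓB, hℓB⟩ :=
    RiemannSystem.exists_tendsto_riemannSum_of_union hdisj.symm F hBA Q₀ R₀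
  refine ⟨ℓA, ℓB, hℓA, hℓB, tendsto_nhds_unique ((hℓA R₀).add (hℓB Q₀)) ?_⟩
  simpa only [← RiemannSystem.riemannSum_union _ _ hdisj] using hAB (R₀.union Q₀ hdisj)
end
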